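/- Theorem of Cantat: for integers n, k ≥ 1, the Cremona group Bir(ℙⁿ_ℂ) = Aut_ℂ(ℂ(x₁,…,xₙ)) embeds into Bir(ℙᵏ_ℂ) = Aut_ℂ(ℂ(x₁,…,x_k)) — i.e. there exists an injective group homomorphism from the first group into the second — if and only if n ≤ k. In particular Bir(ℙⁿ_ℂ) and Bir(ℙᵏ_ℂ) are isomorphic as abstract groups if and only if n = k. -/

import Mathlib

set_option autoImplicit false

noncomputable section

/-- The field `ℂ(x₁,…,xₙ)` of rational functions in `n` variables over `ℂ`. -/
abbrev Kn (n : ℕ) : Type := FractionRing (MvPolynomial (Fin n) ℂ)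

/-- The Cremona group `Bir(ℙⁿ_ℂ)`, identified with `Aut_ℂ(ℂ(x₁,…,xₙ))`. -/
abbrev CremonaN (n : ℕ) : Type := Kn n ≃ₐ[ℂ] Kn n

open scoped TensorProduct

/-- A field extension is algebraic over the polynomial ring on a transcendence basis. -/
theorem IsTranscendenceBasis.isAlgebraic_mvPolynomial {F K ι : Type*} [Field F] [Field K]
    [Algebra F K] {b : ι → K} (hb : IsTranscendenceBasis F b) :
    @Algebra.IsAlgebraic (MvPolynomial ι F) K _ _ (MvPolynomial.aeval b).toAlgebra := by
  let : Algebra (MvPolynomial ι F) K := (MvPolynomial.aeval b).toAlgebra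
  have := hb.isAlgebraic
  rw [Algebra.adjoin_range_eq_range_aeval] at this
  refine ⟨fun x => ?_⟩
  obtain ⟨p, hp, hpx⟩ := this.isAlgebraic x
  let e := AlgEquiv.ofInjective (MvPolynomial.aeval b) hb.1
  refine ⟨p.map e.symm.toRingEquiv.toRingHom, ?_, ?_⟩
  · exact (Polynomial.map_ne_zero_iff e.symm.injective).2 hp
  · rw [Polynomial.aeval_def, Polynomial.eval₂_map]
    rw [Polynomial.aeval_def] at hpx
    convert! hpx using 2
    ext y
    obtain ⟨y, rfl⟩ := e.surjective y
    simp only [RingHom.algebraMap_toAlgebra, RingHom.comp_apply]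
    exact congrArg (MvPolynomial.aeval b) (e.symm_apply_apply y)

/-- Derivations of a field extension of characteristic zero take arbitrary prescribed values on a
transcendence basis. -/
theorem IsTranscendenceBasis.exists_derivation {F K ι : Type*} [Field F] [Field K] [Algebra F K]
    [CharZero F] {b : ι → K} (hb : IsTranscendenceBasis F b) (v : ι → K) :
    ∃ D : Derivation F K K, ∀ i, D (b i) = v i := by
  let : Algebra (MvPolynomial ι F) K := (MvPolynomial.aeval b).toAlgebra
  have : IsScalarTower F (MvPolynomial ι F) K :=
    IsScalarTower.of_algebraMap_eq fun r => ((MvPolynomial.aeval b).commutes r).symm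
  have : FaithfulSMul (MvPolynomial ι F) K :=
    (faithfulSMul_iff_algebraMap_injective _ _).2 hb.1
  let := FractionRing.liftAlgebra (MvPolynomial ι F) K
  have : Algebra.IsAlgebraic (MvPolynomial ι F) K := hb.isAlgebraic_mvPolynomial
  have : Algebra.IsAlgebraic (FractionRing (MvPolynomial ι F)) K :=
    (IsFractionRing.comap_isAlgebraic_iff (A := MvPolynomial ι F)).1 inferInstance
  have : CharZero (FractionRing (MvPolynomial ι F)) := by
    exact charZero_of_injective_algebraMap
      (FaithfulSMul.algebraMap_injective F (FractionRing (MvPolynomial ι F)))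
  have : Algebra.FormallyEtale (MvPolynomial ι F) (FractionRing (MvPolynomial ι F)) :=
    Algebra.FormallyEtale.of_isLocalization (nonZeroDivisors _)
  have : Algebra.FormallyEtale (FractionRing (MvPolynomial ι F)) K :=
    Algebra.FormallyEtale.of_isSeparable _ _
  have : Algebra.FormallyEtale (MvPolynomial ι F) K :=
    Algebra.FormallyEtale.comp _ (FractionRing (MvPolynomial ι F)) _
  let e := KaehlerDifferential.tensorKaehlerEquivOfFormallyEtale F (MvPolynomial ι F) K
  let B := (KaehlerDifferential.mvPolynomialBasis F ι).baseChange K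
  refine ⟨((B.constr K v).comp e.symm.toLinearMap).compDer (KaehlerDifferential.D F K),
    fun i => ?_⟩
  have h := KaehlerDifferential.tensorKaehlerEquivOfFormallyEtale_symm_D_algebraMap F
    (MvPolynomial ι F) K (MvPolynomial.X i)
  have h2 : algebraMap (MvPolynomial ι F) K (MvPolynomial.X i) = b i := by
    simp [RingHom.algebraMap_toAlgebra]
  rw [h2] at h
  have h3 : B i = 1 ⊗ₜ KaehlerDifferential.D F (MvPolynomial ι F) (MvPolynomial.X i) := by
    simp [B, KaehlerDifferential.mvPolynomialBasis_apply]
  simp [e, h, ← h3]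

/-- The field of constants of a derivation. -/
def Derivation.constants {F K M : Type*} [Field F] [Field K] [Algebra F K] [AddCommGroup M]
    [Module F M] [Module K M] (D : Derivation F K M) : IntermediateField F K where
  carrier := {x | D x = 0}
  mul_mem' {a b} ha hb := by
    rw [Set.mem_ofPred_eq] at *; simp [ha, hb]
  add_mem' {a b} ha hb := by
    rw [Set.mem_ofPred_eq] at *; simp [ha, hb]
  algebraMap_mem' r := by simp
  inv_mem' a ha := by
    rw [Set.mem_ofPred_eq] at *; simp [Derivation.leibniz_inv, ha]

/-- In characteristic zero the field of constants of a derivation is algebraically closed in the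
ambient field. -/
theorem Derivation.apply_eq_zero_of_isAlgebraic {F K M : Type*} [Field F] [Field K] [Algebra F K]
    [CharZero K] [AddCommGroup M] [Module F M] [Module K M] (D : Derivation F K M) {s : Set K}
    (hs : ∀ x ∈ s, D x = 0) {x : K} (hx : IsAlgebraic (Algebra.adjoin F s) x) : D x = 0 := by
  let C := D.constants
  have hle : Algebra.adjoin F s ≤ C.toSubalgebra := Algebra.adjoin_le hs
  have hx' : IsAlgebraic C x := hx.tower_top_of_subalgebra_le hle
  let D' : Derivation C K M := Derivation.mk'
    { toFun := D
      map_add' := D.map_add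
      map_smul' := fun r y => by
        have : D (r : K) = 0 := r.2
        have h : r • y = (r : K) * y := rfl
        rw [h, D.leibniz, this, smul_zero, add_zero]
        rfl }
    (fun a b => D.leibniz a b)
  have hint := hx'.isIntegral
  have h := Derivation.map_aeval D' (minpoly C x) x
  rw [minpoly.aeval, map_zero] at h
  have : CharZero C := inferInstance
  have hsep := (minpoly.irreducible hint).separable
  have := hsep.aeval_derivative_ne_zero (minpoly.aeval C x)
  exact (smul_eq_zero.1 h.symm).resolve_left this

/-- A derivation vanishing on a transcendence basis vanishes. -/
theorem Derivation.eq_zero_of_isTranscendenceBasis {F K M ι : Type*} [Field F] [Field K]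
    [Algebra F K] [CharZero K] [AddCommGroup M] [Module F M] [Module K M] (D : Derivation F K M)
    {b : ι → K} (hb : IsTranscendenceBasis F b) (h : ∀ i, D (b i) = 0) : D = 0 := by
  ext x
  refine D.apply_eq_zero_of_isAlgebraic (s := Set.range b) ?_ (hb.isAlgebraic.isAlgebraic x)
  rintro _ ⟨i, rfl⟩
  exact h i

open AlgebraicIndependent in
/-- Given a transcendence basis `y` of `K / k`, a countable set `S` and an uncountable set `U`,
there is a derivation of `K` which stabilises `k`, kills `y` and `S`, but not all of `U`. -/
theorem exists_derivation_apply_ne_zero {k K ι : Type*} [Field k] [Field K] [Algebra k K]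
    [CharZero k] [CharZero K] [Countable ι] {y : ι → K} (hy : IsTranscendenceBasis k y)
    {S U : Set K} (hS : S.Countable) (hU : ¬ U.Countable) :
    ∃ D : Derivation ℚ K K, (∀ a : k, ∃ b : k, D (algebraMap k K a) = algebraMap k K b) ∧
      (∀ i, D (y i) = 0) ∧ (∀ s ∈ S, D s = 0) ∧ ∃ u ∈ U, D u ≠ 0 := by
  classical
  have : IsScalarTower ℚ k K := inferInstance
  obtain ⟨A, hA⟩ := exists_isTranscendenceBasis ℚ k
  have hb := hA.sumElim_comp hy
  set b : ι ⊕ A → K := Sum.elim y (algebraMap k K ∘ (↑)) with hbdef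
  set B : Set K := Set.range b with hBdef
  have hBase : (matroid ℚ K).IsBase B := by
    rw [matroid_isBase_iff]
    exact hb.to_subtype_range
  have hfin : ∀ x : K, ∃ I ⊆ B, I.Finite ∧ x ∈ (matroid ℚ K).closure I := fun x => by
    have hx : x ∈ (matroid ℚ K).closure B := by
      rw [hBase.closure_eq]; trivial
    obtain ⟨I, hI, hI2, -, hxI⟩ := Matroid.exists_mem_finite_closure_of_mem_closure hx
    exact ⟨I, hI, hI2, hxI⟩
  choose I hIB hIfin hI using hfin
  have halg : ∀ {x : K} {s : Set K}, x ∈ (matroid ℚ K).closure s →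
      IsAlgebraic (Algebra.adjoin ℚ s) x := fun {x s} hx => by
    rw [matroid_closure_eq] at hx
    exact hx
  let J : Set K := Set.range y ∪ ⋃ s ∈ S, I s
  have hJB : J ⊆ B := by
    refine Set.union_subset ?_ (Set.iUnion₂_subset fun s _ => hIB s)
    rintro _ ⟨i, rfl⟩
    exact ⟨Sum.inl i, rfl⟩
  have hJc : J.Countable :=
    (Set.countable_range y).union (hS.biUnion fun s _ => (hIfin s).countable)
  have hclc : ((matroid ℚ K).closure J).Countable := by
    have h1 : Cardinal.mk (Algebra.adjoin ℚ J) ≤ Cardinal.aleph0 := by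
      have h := Algebra.lift_cardinalMk_adjoin_le ℚ J
      rw [Cardinal.lift_uzero] at h
      exact h.trans (max_le (max_le (by simp) (by simpa using hJc)) le_rfl)
    have h2 := Algebra.IsAlgebraic.cardinalMk_le_max (Algebra.adjoin ℚ J)
      (Subalgebra.algebraicClosure (Algebra.adjoin ℚ J) K)
    rw [matroid_closure_eq, ← Cardinal.le_aleph0_iff_set_countable]
    exact h2.trans (max_le h1 le_rfl)
  obtain ⟨u, huU, hu⟩ : ∃ u ∈ U, u ∉ (matroid ℚ K).closure J := by
    by_contra! h
    exact hU (hclc.mono h)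
  have hJind : (matroid ℚ K).Indep J := hBase.indep.subset hJB
  have hins : (matroid ℚ K).Indep (insert u J) :=
    hJind.insert_indep_iff.2 (Or.inl ⟨Set.mem_univ _, hu⟩)
  obtain ⟨B', hB', hsub⟩ := hins.exists_isBase_superset
  rw [matroid_isBase_iff] at hB'
  obtain ⟨D, hD⟩ := hB'.exists_derivation (fun x => if (x : K) = u then 1 else 0)
  have huJ : u ∉ J := fun h => hu ((matroid ℚ K).mem_closure_of_mem h (by simp))
  have hDu : D u = 1 := by simpa using hD ⟨u, hsub (Set.mem_insert _ _)⟩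
  have hDJ : ∀ x ∈ J, D x = 0 := fun x hx => by
    have := hD ⟨x, hsub (Set.mem_insert_of_mem _ hx)⟩
    rwa [if_neg (ne_of_mem_of_not_mem hx huJ)] at this
  choose E hE using fun j => hb.exists_derivation (Pi.single j 1)
  have hinj : Function.Injective b := hb.1.injective
  let F : Finset (ι ⊕ A) := ((hIfin u).preimage hinj.injOn).toFinset
  have hF : ∀ j, j ∈ F ↔ b j ∈ I u := fun j => by simp [F]
  have hEsum : ∀ x, (∑ j ∈ F, D (b j) • E j) x = ∑ j ∈ F, D (b j) * E j x := fun x => by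
    have := congr($(map_sum Derivation.coeFnAddMonoidHom (fun j => D (b j) • E j) F) x)
    rw [Finset.sum_apply] at this
    exact this
  have hsum : D u = ∑ j ∈ F, D (b j) * E j u := by
    have h0 : (D - ∑ j ∈ F, D (b j) • E j) u = 0 := by
      refine Derivation.apply_eq_zero_of_isAlgebraic _ (s := I u) ?_ (halg (hI u))
      intro x hx
      obtain ⟨j, rfl⟩ := hIB u hx
      have : ∀ l, E l (b j) = if j = l then 1 else 0 := fun l => by
        rw [hE, Pi.single_apply]
      simp [hEsum, this, hF, hx]
    simpa [hEsum, sub_eq_zero] using h0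
  obtain ⟨j, hjF, hj⟩ : ∃ j ∈ F, D (b j) * E j u ≠ 0 := by
    by_contra! h
    rw [Finset.sum_eq_zero h, hDu] at hsum
    exact one_ne_zero hsum
  have hjJ : b j ∉ J := fun h => hj (by rw [hDJ _ h, zero_mul])
  obtain (i | a) := j
  · exact absurd (Or.inl ⟨i, rfl⟩) hjJ
  refine ⟨E (Sum.inr a), ?_, fun i => ?_, fun s hs => ?_, u, huU, right_ne_zero_of_mul hj⟩
  · obtain ⟨δ, hδ⟩ := hA.exists_derivation (Pi.single a 1)
    intro c
    refine ⟨δ c, ?_⟩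
    have : (E (Sum.inr a)).compAlgebraMap k - (Algebra.linearMap k K).compDer δ = 0 := by
      refine Derivation.eq_zero_of_isTranscendenceBasis _ hA fun i => ?_
      have h1 := hE (Sum.inr a) (Sum.inr i)
      simp only [hbdef, Sum.elim_inr, Function.comp_apply] at h1
      rw [Derivation.sub_apply, Derivation.compAlgebraMap_apply, h1]
      change _ - algebraMap k K (δ i) = 0
      rw [hδ]
      simp only [Pi.single_apply, Sum.inr.injEq]
      split_ifs <;> simp
    simpa [sub_eq_zero] using congr($this c)
  · have := hE (Sum.inr a) (Sum.inl i)
    simpa [hbdef] using this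
  · refine Derivation.apply_eq_zero_of_isAlgebraic _ (s := I s) ?_ (halg (hI s))
    intro x hx
    obtain ⟨j, rfl⟩ := hIB s hx
    rw [hE, Pi.single_eq_of_ne]
    rintro rfl
    exact hjJ (Or.inr (Set.mem_biUnion hs hx))

/-- Linearly independent elements of `L` stay linearly independent over rational functions in
elements which are algebraically independent over `L`. -/
theorem AlgebraicIndependent.linearIndependent_mvPolynomial {M L K κ ι : Type*} [Field M] [Field L]
    [Field K] [Algebra M L] [Algebra L K] [Algebra M K] [IsScalarTower M L K] {w : κ → K}
    (hw : AlgebraicIndependent L w) {v : ι → L} (hv : LinearIndependent M v) :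
    @LinearIndependent ι (MvPolynomial κ M) K (algebraMap L K ∘ v) _ _
      (MvPolynomial.aeval w).toAlgebra.toModule := by
  let : Algebra (MvPolynomial κ M) K := (MvPolynomial.aeval w).toAlgebra
  rw [linearIndependent_iff']
  intro s g hg i hi
  have hsmul : ∀ j, g j • algebraMap L K (v j) =
      MvPolynomial.aeval w (MvPolynomial.C (v j) * MvPolynomial.map (algebraMap M L) (g j)) := by
    intro j
    rw [map_mul, MvPolynomial.aeval_map_algebraMap, MvPolynomial.aeval_C]
    exact mul_comm _ _
  simp only [Function.comp_apply, hsmul] at hg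
  rw [← map_sum] at hg
  have h0 := (injective_iff_map_eq_zero _).1 hw _ hg
  ext m
  have hm := congr(MvPolynomial.coeff m $h0)
  simp only [MvPolynomial.coeff_sum, MvPolynomial.coeff_C_mul, MvPolynomial.coeff_map,
    MvPolynomial.coeff_zero] at hm
  exact linearIndependent_iff'.1 hv s (fun j => (g j).coeff m)
    (by simpa [Algebra.smul_def, mul_comm] using hm) i hi

/-- An algebraic subextension of a finitely generated field extension is finite. -/
theorem FiniteDimensional.of_isAlgebraic_of_essFiniteType (M L K : Type*) [Field M] [Field L]
    [Field K] [Algebra M L] [Algebra L K] [Algebra M K] [IsScalarTower M L K]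
    [Algebra.EssFiniteType M K] [Algebra.IsAlgebraic M L] : FiniteDimensional M L := by
  obtain ⟨s, hs⟩ := exists_isTranscendenceBasis L K
  have hsM : IsTranscendenceBasis M ((↑) : s → K) :=
    (Algebra.IsAlgebraic.isTranscendenceBasis_iff M L).2 hs
  let : Algebra (MvPolynomial s M) K := (MvPolynomial.aeval ((↑) : s → K)).toAlgebra
  have : IsScalarTower M (MvPolynomial s M) K :=
    IsScalarTower.of_algebraMap_eq fun r => ((MvPolynomial.aeval ((↑) : s → K)).commutes r).symm
  have : FaithfulSMul (MvPolynomial s M) K := (faithfulSMul_iff_algebraMap_injective _ _).2 hsM.1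
  let := FractionRing.liftAlgebra (MvPolynomial s M) K
  have : Algebra.IsAlgebraic (MvPolynomial s M) K := hsM.isAlgebraic_mvPolynomial
  have : Algebra.IsAlgebraic (FractionRing (MvPolynomial s M)) K :=
    (IsFractionRing.comap_isAlgebraic_iff (A := MvPolynomial s M)).1 inferInstance
  have : IsScalarTower M (FractionRing (MvPolynomial s M)) K :=
    IsScalarTower.to₁₃₄ M (MvPolynomial s M) (FractionRing (MvPolynomial s M)) K
  have : Algebra.EssFiniteType (FractionRing (MvPolynomial s M)) K :=
    Algebra.EssFiniteType.of_comp M _ _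
  have : FiniteDimensional (FractionRing (MvPolynomial s M)) K :=
    Algebra.finite_of_essFiniteType_of_isAlgebraic
  let v := Module.Basis.ofVectorSpace M L
  have hv : LinearIndependent (MvPolynomial s M) (algebraMap L K ∘ v) :=
    hs.1.linearIndependent_mvPolynomial v.linearIndependent
  have hv' := (LinearIndependent.iff_fractionRing (MvPolynomial s M)
    (FractionRing (MvPolynomial s M))).1 hv
  have := hv'.finite
  exact Module.Finite.of_basis v

/-- Subextensions of finitely generated field extensions are finitely generated. -/
theorem Algebra.EssFiniteType.of_field_tower (k L K : Type*) [Field k] [Field L] [Field K]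
    [Algebra k L] [Algebra L K] [Algebra k K] [IsScalarTower k L K] [Algebra.EssFiniteType k K] :
    Algebra.EssFiniteType k L := by
  obtain ⟨s, hs⟩ := exists_isTranscendenceBasis k L
  have hs' : AlgebraicIndependent k (algebraMap L K ∘ ((↑) : s → L)) :=
    hs.1.map' (f := IsScalarTower.toAlgHom k L K) (algebraMap L K).injective
  have : Finite s := finite_of_algebraicIndependent hs'
  let M := IntermediateField.adjoin k (Set.range ((↑) : s → L))
  have : Algebra.IsAlgebraic M L := hs.isAlgebraic_field
  have : Algebra.EssFiniteType k M :=
    IntermediateField.essFiniteType_iff.2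
      (IntermediateField.fg_adjoin_of_finite (Set.finite_range _))
  have : Algebra.EssFiniteType M K := Algebra.EssFiniteType.of_comp k _ _
  have : FiniteDimensional M L := FiniteDimensional.of_isAlgebraic_of_essFiniteType M L K
  exact Algebra.EssFiniteType.comp k M L

section FixedField

variable {k K : Type*} [Field k] [Field K] [Algebra k K]

/-- The field of elements fixed by every automorphism in a set. -/
def invariantField (S : Set (K ≃ₐ[k] K)) : IntermediateField k K where
  carrier := {x | ∀ s ∈ S, s x = x}
  mul_mem' ha hb s hs := by rw [map_mul, ha s hs, hb s hs]
  add_mem' ha hb s hs := by rw [map_add, ha s hs, hb s hs]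
  algebraMap_mem' r s _ := s.commutes r
  inv_mem' a ha s hs := by rw [map_inv₀, ha s hs]

theorem mem_invariantField {S : Set (K ≃ₐ[k] K)} {x : K} :
    x ∈ invariantField S ↔ ∀ s ∈ S, s x = x := Iff.rfl

theorem invariantField_antitone {S T : Set (K ≃ₐ[k] K)} (h : S ⊆ T) :
    invariantField T ≤ invariantField S := fun _ hx s hs => hx s (h hs)

/-- A divisible group of automorphisms acts trivially on elements algebraic over its fixed
field. -/
theorem apply_eq_of_isAlgebraic {τ : ℚ → (K ≃ₐ[k] K)} (hτ : ∀ p q, τ (p + q) = τ p * τ q)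
    {M : IntermediateField k K} (hM : ∀ q, ∀ x ∈ M, τ q x = x) {f : K} (hf : IsAlgebraic M f)
    (q : ℚ) : τ q f = f := by
  have h0 : τ 0 = 1 := by simpa using hτ 0 0
  let H : AddSubgroup ℚ :=
    { carrier := {q | τ q f = f}
      add_mem' := fun {a b} ha hb => by
        rw [Set.mem_ofPred_eq] at *
        rw [hτ, AlgEquiv.mul_apply, hb, ha]
      zero_mem' := by simp [h0]
      neg_mem' := fun {a} ha => by
        rw [Set.mem_ofPred_eq] at *
        have : τ (-a) (τ a f) = f := by
          rw [← AlgEquiv.mul_apply, ← hτ, neg_add_cancel, h0, AlgEquiv.one_apply]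
        rwa [ha] at this }
  let R := ((minpoly M f).rootSet K)
  have hR : ∀ q, τ q f ∈ R := by
    intro q
    rw [Polynomial.mem_rootSet]
    refine ⟨minpoly.ne_zero hf.isIntegral, ?_⟩
    let σ : K →ₐ[M] K :=
      { (τ q : K →+* K) with commutes' := fun x => hM q x x.2 }
    have h := Polynomial.aeval_algHom_apply σ f (minpoly M f)
    rw [minpoly.aeval, map_zero] at h
    exact h
  have : Finite (ℚ ⧸ H) := by
    have : Finite R := Polynomial.rootSet_finite _ _
    refine Finite.of_injective (fun x : ℚ ⧸ H => (⟨τ x.out f, hR _⟩ : R)) fun x y hxy => ?_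
    have h1 : τ x.out f = τ y.out f := congr($hxy.1)
    rw [← x.out_eq', ← y.out_eq']
    refine QuotientAddGroup.eq.2 ?_
    change τ (-x.out + y.out) f = f
    rw [hτ, AlgEquiv.mul_apply, ← h1, ← AlgEquiv.mul_apply, ← hτ, neg_add_cancel, h0,
      AlgEquiv.one_apply]
  have hn : H.index ≠ 0 := AddSubgroup.index_ne_zero_of_finite
  have := H.nsmul_index_mem (q / H.index)
  rwa [nsmul_eq_mul, mul_div_cancel₀ _ (Nat.cast_ne_zero.2 hn)] at this

/-- If `L₁ ≤ L₂` have the same finite transcendence degree, then `L₂` is algebraic over `L₁`. -/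
theorem IntermediateField.isAlgebraic_of_trdeg_le {L₁ L₂ : IntermediateField k K} (h : L₁ ≤ L₂)
    (hfin : Algebra.trdeg k L₁ < Cardinal.aleph0)
    (htr : Algebra.trdeg k L₂ ≤ Algebra.trdeg k L₁) {x : K} (hx : x ∈ L₂) : IsAlgebraic L₁ x := by
  let E := IntermediateField.extendScalars h
  have : FaithfulSMul L₁ E :=
    (faithfulSMul_iff_algebraMap_injective L₁ E).2 (algebraMap L₁ E).injective
  have h1 : Algebra.trdeg k L₁ + Algebra.trdeg L₁ E = Algebra.trdeg k L₂ :=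
    trdeg_add_eq k L₁ (A := E)
  have h2 : Algebra.trdeg L₁ E = 0 := by
    have h3 : Algebra.trdeg k L₁ + Algebra.trdeg L₁ E ≤ Algebra.trdeg k L₁ + 0 := by
      rw [h1, add_zero]; exact htr
    exact le_antisymm ((Cardinal.add_le_add_iff_of_lt_aleph0 hfin).1
      (by rwa [add_comm, add_comm 0])) zero_le
  have : Algebra.IsAlgebraic L₁ E := trdeg_eq_zero_iff.1 h2
  exact (Algebra.IsAlgebraic.isAlgebraic (R := L₁) (⟨x, hx⟩ : E)).algebraMap (A := K)

variable (T : Set (K ≃ₐ[k] K))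

/-- Every element of `T` belongs to the image of an additive map `ℚ → T`. -/
def IsRationallyDivisible : Prop :=
  ∀ t ∈ T, ∃ τ : ℚ → (K ≃ₐ[k] K), (∀ p q, τ (p + q) = τ p * τ q) ∧ (∀ q, τ q ∈ T) ∧ τ 1 = t

variable {T}

theorem IsRationallyDivisible.invariantField_isAlgClosed (hT : IsRationallyDivisible T) {f : K}
    (hf : IsAlgebraic (invariantField T) f) : f ∈ invariantField T := by
  intro t ht
  obtain ⟨τ, hτ, hτT, rfl⟩ := hT t ht
  exact apply_eq_of_isAlgebraic (M := invariantField T) hτ (fun q x hx => hx _ (hτT q)) hf 1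

/-- The fixed field of a rationally divisible set is the fixed field of a countable subset. -/
theorem IsRationallyDivisible.exists_countable_invariantField_eq [FinTrdeg k K]
    (hT : IsRationallyDivisible T) :
    ∃ S ⊆ T, S.Countable ∧ invariantField S = invariantField T := by
  let P : Set (Set (K ≃ₐ[k] K)) := {S | S ⊆ T ∧ S.Countable}
  have hP : P.Nonempty := ⟨∅, Set.empty_subset _, Set.countable_empty⟩
  let φ : Set (K ≃ₐ[k] K) → Cardinal := fun S => Algebra.trdeg k (invariantField S)
  have hmin := fun S (hS : S ∈ P) => Function.not_lt_argminOn φ P hS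
  have hmem := Function.argminOn_mem φ P hP
  set S₀ := Function.argminOn φ P hP
  refine ⟨S₀, hmem.1, hmem.2, le_antisymm (fun x hx t ht => ?_) (invariantField_antitone hmem.1)⟩
  obtain ⟨τ, hτ, hτT, rfl⟩ := hT t ht
  have hS : S₀ ∪ Set.range τ ∈ P := ⟨Set.union_subset hmem.1 (Set.range_subset_iff.2 hτT),
    hmem.2.union (Set.countable_range τ)⟩
  have hfin : Algebra.trdeg k (invariantField (S₀ ∪ Set.range τ)) < Cardinal.aleph0 := by
    refine lt_of_le_of_lt ?_ (trdeg_lt_aleph0 k K)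
    rw [← trdeg_add_eq k (invariantField (S₀ ∪ Set.range τ)) (A := K)]
    exact self_le_add_right _ _
  have halg := IntermediateField.isAlgebraic_of_trdeg_le
    (invariantField_antitone (Set.subset_union_left (s := S₀) (t := Set.range τ)))
    hfin (not_lt.1 (hmin _ hS)) hx
  exact apply_eq_of_isAlgebraic (M := invariantField (S₀ ∪ Set.range τ)) hτ
    (fun q y hy => hy _ (Or.inr ⟨q, rfl⟩)) halg 1

end FixedField

section Conj

variable {k K : Type*} [Field k] [Field K] [Algebra k K]

/-- Conjugation of derivations by an automorphism. -/
def Derivation.conj (t : K ≃ₐ[k] K) :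
    Derivation k K K →ₛₗ[(t : K →+* K)] Derivation k K K where
  toFun D := Derivation.mk' (t.toLinearMap ∘ₗ D.toLinearMap ∘ₗ t.symm.toLinearMap) (by simp)
  map_add' _ _ := by ext; exact map_add t _ _
  map_smul' _ _ := by ext; exact map_mul t _ _

@[simp]
theorem Derivation.conj_apply (t : K ≃ₐ[k] K) (D : Derivation k K K) (x : K) :
    Derivation.conj t D x = t (D (t.symm x)) := rfl

theorem Derivation.conj_injective (t : K ≃ₐ[k] K) :
    Function.Injective (Derivation.conj t) := by
  intro D E h
  ext x
  have := congr($h (t x))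
  simpa using this

/-- The coefficients of a fixed vector in terms of independent fixed vectors are fixed. -/
theorem LinearIndepOn.map_coeff_eq {V ι : Type*} [AddCommGroup V] [Module K V] {σ : K →+* K}
    (φ : V →ₛₗ[σ] V) {v : ι → V} {s : Finset ι} (hv : LinearIndepOn K v (s : Set ι))
    (hφ : ∀ i ∈ s, φ (v i) = v i) {c : ι → K} (hc : φ (∑ i ∈ s, c i • v i) = ∑ i ∈ s, c i • v i)
    {i : ι} (hi : i ∈ s) : σ (c i) = c i := by
  have h : ∑ i ∈ s, (σ (c i) - c i) • v i = 0 := by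
    simp_rw [sub_smul, Finset.sum_sub_distrib]
    rw [sub_eq_zero, ← hc, map_sum]
    exact Finset.sum_congr rfl fun j hj => by rw [map_smulₛₗ, hφ j hj]
  exact sub_eq_zero.1 (linearIndepOn_finset_iff.1 hv _ h i hi)

/-- The derivations fixed by every automorphism in a set. -/
def invariantDerivations (S : Set (K ≃ₐ[k] K)) : Set (Derivation k K K) :=
  {D | ∀ s ∈ S, Derivation.conj s D = D}

theorem invariantDerivations_antitone {S T : Set (K ≃ₐ[k] K)} (h : S ⊆ T) :
    invariantDerivations T ⊆ invariantDerivations S := fun _ hD s hs => hD s (h hs)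

/-- Evaluation of derivations on a family of elements. -/
def Derivation.evalPi {ι : Type*} (y : ι → K) : Derivation k K K →ₗ[K] (ι → K) where
  toFun D i := D (y i)
  map_add' _ _ := rfl
  map_smul' _ _ := rfl

theorem Derivation.evalPi_injective [CharZero K] {ι : Type*} {y : ι → K}
    (hy : IsTranscendenceBasis k y) : Function.Injective (Derivation.evalPi (k := k) y) := by
  rw [injective_iff_map_eq_zero]
  exact fun D hD => D.eq_zero_of_isTranscendenceBasis hy fun i =>
    _root_.congr_fun hD i

theorem Derivation.finiteDimensional [CharZero K] [FinTrdeg k K] :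
    FiniteDimensional K (Derivation k K K) := by
  obtain ⟨s, hs⟩ := exists_finset_isTranscendenceBasis k K
  exact Module.Finite.of_injective _ (Derivation.evalPi_injective hs)

/-- Enlarging a countable set computing the fixed field of `T`, one also computes the derivations
fixed by `T`. -/
theorem exists_countable_invariantDerivations_subset [CharZero K] [FinTrdeg k K]
    {S T : Set (K ≃ₐ[k] K)} (hST : S ⊆ T) (hS : S.Countable)
    (hinv : invariantField S = invariantField T) :
    ∃ S' ⊆ T, S'.Countable ∧ invariantDerivations S' ⊆ invariantDerivations T := by
  have := Derivation.finiteDimensional (k := k) (K := K)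
  let P : Set (Set (K ≃ₐ[k] K)) := {S' | S ⊆ S' ∧ S' ⊆ T ∧ S'.Countable}
  have hP : P.Nonempty := ⟨S, subset_rfl, hST, hS⟩
  let φ : Set (K ≃ₐ[k] K) → ℕ :=
    fun S => Module.finrank K (Submodule.span K (invariantDerivations S))
  have hmin := fun S (hS : S ∈ P) => Function.not_lt_argminOn φ P hS
  have hmem := Function.argminOn_mem φ P hP
  set S₁ := Function.argminOn φ P hP
  refine ⟨S₁, hmem.2.1, hmem.2.2, fun D hD t ht => ?_⟩
  have hins : insert t S₁ ∈ P := ⟨hmem.1.trans (Set.subset_insert _ _),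
    Set.insert_subset ht hmem.2.1, hmem.2.2.insert t⟩
  have hspan : Submodule.span K (invariantDerivations (insert t S₁)) =
      Submodule.span K (invariantDerivations S₁) :=
    Submodule.eq_of_le_of_finrank_le
      (Submodule.span_mono (invariantDerivations_antitone (Set.subset_insert _ _)))
      (not_lt.1 (hmin _ hins))
  obtain ⟨B, hB, hBspan, hBind⟩ :=
    exists_linearIndependent K (invariantDerivations (insert t S₁))
  have hDB : D ∈ Submodule.span K (Set.range ((↑) : B → Derivation k K K)) := by
    rw [Subtype.range_coe, hBspan, hspan]
    exact Submodule.subset_span hD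
  obtain ⟨c, rfl⟩ := Finsupp.mem_span_range_iff_exists_finsupp.1 hDB
  have hc : ∀ i ∈ c.support, c i ∈ invariantField T := by
    intro i hi
    rw [← hinv]
    intro s hs
    exact (hBind.linearIndepOn _).map_coeff_eq (Derivation.conj s)
      (fun b _ => hB b.2 s (Set.mem_insert_of_mem _ (hmem.1 hs))) (hD s (hmem.1 hs)) hi
  rw [Finsupp.sum, map_sum]
  refine Finset.sum_congr rfl fun i hi => ?_
  rw [map_smulₛₗ, hB i.2 t (Set.mem_insert _ _)]
  exact congr($(hc i hi t ht) • _)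

end Conj

section AffineSteinberg

variable {k G : Type*} [Field k] [Group G] {n : ℕ}

/-- The relations satisfied by the elementary affine transformations: for `i ≠ j`, the element
`x i (some j) a` stands for the transvection adding `a` times the `j`-th coordinate to the `i`-th
one, and `x i none a` stands for the translation by `a` along the `i`-th coordinate. -/
structure IsAffineSteinberg (x : Fin n → Option (Fin n) → k → G) : Prop where
  map_add : ∀ {i β}, some i ≠ β → ∀ a b, x i β (a + b) = x i β a * x i β b
  mul_comm_eq : ∀ {i j β}, i ≠ j → some j ≠ β → some i ≠ β → ∀ a b,
    x j β b * x i (some j) a = x i β (a * b) * x i (some j) a * x j β b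
  commute : ∀ {i j β γ}, some i ≠ β → some j ≠ γ → some j ≠ β → some i ≠ γ → ∀ a b,
    Commute (x i β a) (x j γ b)

namespace IsAffineSteinberg

variable {x : Fin n → Option (Fin n) → k → G}

theorem map_zero (hx : IsAffineSteinberg x) {i : Fin n} {β : Option (Fin n)} (h : some i ≠ β) :
    x i β 0 = 1 := by
  simpa using hx.map_add h 0 0

theorem map_neg (hx : IsAffineSteinberg x) {i : Fin n} {β : Option (Fin n)} (h : some i ≠ β)
    (a : k) : x i β (-a) = (x i β a)⁻¹ := by
  rw [eq_inv_iff_mul_eq_one, ← hx.map_add h, neg_add_cancel, hx.map_zero h]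

theorem commute_translation (hx : IsAffineSteinberg x) (i j : Fin n) (a b : k) :
    Commute (x i none a) (x j none b) := by
  apply hx.commute <;> simp

theorem commute_transvection (hx : IsAffineSteinberg x) {i j l : Fin n} (hij : i ≠ j)
    (hlj : l ≠ j) (a b : k) : Commute (x i (some j) a) (x l none b) := by
  apply hx.commute <;> simp [hij, hlj]

theorem translation_mul_transvection (hx : IsAffineSteinberg x) {i j : Fin n} (hij : i ≠ j)
    (a b : k) :
    x j none b * x i (some j) a = x i none (a * b) * x i (some j) a * x j none b :=
  hx.mul_comm_eq hij (by simp) (by simp) a b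

theorem translation_eq_one_of_ne (hx : IsAffineSteinberg x) {i j : Fin n} (hij : i ≠ j) {c : k}
    (hc : c ≠ 0) (h : x j none c = 1) (b : k) : x i none b = 1 := by
  have := hx.translation_mul_transvection hij (b / c) c
  rwa [h, one_mul, mul_one, div_mul_cancel₀ _ hc, eq_comm, mul_eq_right] at this

theorem injective_translation (hx : IsAffineSteinberg x) [Nontrivial (Fin n)] {i : Fin n} {c₀ : k}
    (h₀ : x i none c₀ ≠ 1) : Function.Injective (x i none) := by
  intro a b hab
  by_contra! hne
  obtain ⟨j, hj⟩ := exists_ne i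
  have h1 : x i none (a - b) = 1 := by
    rw [sub_eq_add_neg, hx.map_add (by simp), hx.map_neg (by simp), hab, mul_inv_cancel]
  have h2 := hx.translation_eq_one_of_ne hj (sub_ne_zero.2 hne) h1 1
  exact h₀ (hx.translation_eq_one_of_ne hj.symm one_ne_zero h2 c₀)

theorem map (hx : IsAffineSteinberg x) {H : Type*} [Group H] (φ : G →* H) :
    IsAffineSteinberg fun i β a => φ (x i β a) where
  map_add h a b := by rw [hx.map_add h, map_mul]
  mul_comm_eq h₁ h₂ h₃ a b := by rw [← map_mul, hx.mul_comm_eq h₁ h₂ h₃, map_mul, map_mul]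
  commute h₁ h₂ h₃ h₄ a b := (hx.commute h₁ h₂ h₃ h₄ a b).map φ

end IsAffineSteinberg

end AffineSteinberg

section Unipotent

variable {k K : Type*} [Field k] [Field K] [Algebra k K]

/-- Invariant derivations permuted unipotently in all directions are linearly independent. -/
theorem linearIndependent_of_conj_eq_sub {ι : Type*} [Nontrivial ι] {T : Set (K ≃ₐ[k] K)}
    {u : ι → ι → (K ≃ₐ[k] K)} {d : ι → Derivation k K K}
    (hu : ∀ i j, i ≠ j → ∀ f ∈ invariantField T, u i j f = f)
    (hd : ∀ i, d i ∈ invariantDerivations T)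
    (hsub : ∀ i j, i ≠ j → Derivation.conj (u i j) (d j) = d j - d i)
    (heq : ∀ i j l, i ≠ j → l ≠ j → Derivation.conj (u i j) (d l) = d l)
    {i₀ : ι} (h₀ : d i₀ ≠ 0) : LinearIndependent K d := by
  have hne : ∀ i, d i ≠ 0 := by
    intro i hi
    obtain rfl | h := eq_or_ne i₀ i
    · exact h₀ hi
    have := hsub i₀ i h
    rw [hi, map_zero, zero_sub, eq_comm, neg_eq_zero] at this
    exact h₀ this
  rw [← linearIndepOn_univ_iff, linearIndepOn_iff_linearIndepOn_finset]
  intro s _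
  classical
  induction s using Finset.induction_on with
  | empty => simp
  | insert a s ha ih =>
    rw [Finset.coe_insert, linearIndepOn_insert (by simpa using ha)]
    refine ⟨ih (Set.subset_univ _), fun hmem => ?_⟩
    obtain ⟨c', hc'⟩ := (Submodule.mem_span_image_finset_iff_exists_fun K).1 hmem
    obtain ⟨c, hc⟩ : ∃ c : ι → K, ∑ i ∈ s, c i • d i = d a := by
      refine ⟨fun i => if h : i ∈ s then c' ⟨i, h⟩ else 0, ?_⟩
      rw [← hc', ← Finset.sum_coe_sort]
      exact Finset.sum_congr rfl fun i _ => by simp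
    have hcL : ∀ i ∈ s, c i ∈ invariantField T := fun i hi t ht =>
      (ih (Set.subset_univ _)).map_coeff_eq (Derivation.conj t) (fun i _ => hd i t ht)
        (by rw [hc]; exact hd a t ht) hi
    obtain ⟨i, hi⟩ := exists_ne a
    refine hne i ?_
    have h := hsub i a hi
    rw [← hc, map_sum] at h
    have h' : ∑ l ∈ s, Derivation.conj (u i a) (c l • d l) = ∑ l ∈ s, c l • d l := by
      refine Finset.sum_congr rfl fun l hl => ?_
      rw [map_smulₛₗ, heq i a l hi (by rintro rfl; exact ha hl)]
      exact congr($(hu i a hi _ (hcL l hl)) • _)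
    rwa [h', eq_comm, sub_eq_self] at h

variable [CharZero K]

/-- The cocycle measuring the failure of automorphisms to commute with a derivation. -/
def Derivation.cocycle (D : Derivation ℚ K K)
    (hD : ∀ a : k, ∃ b : k, D (algebraMap k K a) = algebraMap k K b) (t : K ≃ₐ[k] K) :
    Derivation k K K :=
  Derivation.mk'
    { toFun := fun f => t (D (t.symm f)) - D f
      map_add' := fun f g => by simp only [map_add]; ring
      map_smul' := fun a f => by
        obtain ⟨b, hb⟩ := hD a
        simp only [Algebra.smul_def, map_mul, AlgEquiv.commutes, leibniz, hb, map_add,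
          Algebra.algebraMap_self_apply, AlgEquiv.apply_symm_apply, RingHom.id_apply]
        ring }
    fun f g => by
      simp only [LinearMap.coe_mk, AddHom.coe_mk, map_mul, leibniz, map_add, smul_eq_mul,
        AlgEquiv.apply_symm_apply]
      ring

theorem Derivation.cocycle_apply (D : Derivation ℚ K K)
    (hD : ∀ a : k, ∃ b : k, D (algebraMap k K a) = algebraMap k K b) (t : K ≃ₐ[k] K) (f : K) :
    D.cocycle hD t f = t (D (t.symm f)) - D f := rfl

theorem Derivation.cocycle_mul (D : Derivation ℚ K K)
    (hD : ∀ a : k, ∃ b : k, D (algebraMap k K a) = algebraMap k K b) (s t : K ≃ₐ[k] K) :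
    D.cocycle hD (s * t) = Derivation.conj s (D.cocycle hD t) + D.cocycle hD s := by
  ext f
  have h : (s * t).symm f = t.symm (s.symm f) := rfl
  simp only [cocycle_apply, add_apply, conj_apply, map_sub, AlgEquiv.mul_apply, h]
  ring

/-- If the derivation kills a transcendence basis and its image by `t`, the cocycle vanishes at
`t`. -/
theorem Derivation.cocycle_eq_zero (D : Derivation ℚ K K)
    (hD : ∀ a : k, ∃ b : k, D (algebraMap k K a) = algebraMap k K b) {ι : Type*} {y : ι → K}
    (hy : IsTranscendenceBasis k y) (t : K ≃ₐ[k] K) (h₁ : ∀ i, D (y i) = 0)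
    (h₂ : ∀ i, D (t (y i)) = 0) : D.cocycle hD t = 0 := by
  refine Derivation.eq_zero_of_isTranscendenceBasis _ (t.isTranscendenceBasis hy) fun i => ?_
  simp [cocycle_apply, h₁, h₂]

end Unipotent

section Restrict

variable {k K : Type*} [Field k] [Field K] [Algebra k K]

open Classical in
/-- The restriction of an automorphism to an intermediate field it preserves (and the identity if
it does not preserve that field). -/
noncomputable def IntermediateField.restrictAut (L : IntermediateField k K) (g : K ≃ₐ[k] K) :
    L ≃ₐ[k] L :=
  if h : L.map (g : K →ₐ[k] K) = L then
    (IntermediateField.intermediateFieldMap g L).trans (IntermediateField.equivOfEq h)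
  else 1

theorem IntermediateField.restrictAut_apply {L : IntermediateField k K} {g : K ≃ₐ[k] K}
    (h₁ : ∀ f ∈ L, g f ∈ L) (h₂ : ∀ f ∈ L, g⁻¹ f ∈ L) (f : L) :
    (L.restrictAut g f : K) = g f := by
  have h : L.map (g : K →ₐ[k] K) = L := by
    refine le_antisymm ?_ fun f hf => ⟨g⁻¹ f, h₂ f hf, g.apply_symm_apply f⟩
    rintro _ ⟨f, hf, rfl⟩
    exact h₁ f hf
  rw [restrictAut, dif_pos h]
  rfl

end Restrict

universe u v

section Main

variable {k : Type u} {K : Type v} [Field k] [Field K] [Algebra k K] {n : ℕ}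
  {x : Fin n → Option (Fin n) → k → (K ≃ₐ[k] K)}

namespace IsAffineSteinberg

/-- The set of translations. -/
def translations (x : Fin n → Option (Fin n) → k → (K ≃ₐ[k] K)) : Set (K ≃ₐ[k] K) :=
  Set.range fun p : Fin n × k => x p.1 none p.2

theorem isRationallyDivisible [CharZero k] (hx : IsAffineSteinberg x) :
    IsRationallyDivisible (translations x) := by
  rintro _ ⟨⟨i, c⟩, rfl⟩
  refine ⟨fun q => x i none (q * c), fun p q => ?_, fun q => ⟨(i, q * c), rfl⟩, by simp⟩
  rw [← hx.map_add (by simp)]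
  push_cast
  rw [add_mul]

theorem mem_invariantField_translations {f : K} :
    f ∈ invariantField (translations x) ↔ ∀ i c, x i none c f = f := by
  simp only [mem_invariantField, translations, Set.forall_mem_range, Prod.forall]

theorem transvection_mem_invariantField (hx : IsAffineSteinberg x) {i j : Fin n} (hij : i ≠ j)
    (a : k) {f : K} (hf : f ∈ invariantField (translations x)) :
    x i (some j) a f ∈ invariantField (translations x) := by
  rw [mem_invariantField_translations] at hf ⊢
  have h : ∀ l, l ≠ j → ∀ c, x l none c (x i (some j) a f) = x i (some j) a f := by
    intro l hl c
    rw [← AlgEquiv.mul_apply, ← (hx.commute_transvection hij hl a c).eq, AlgEquiv.mul_apply, hf]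
  intro l c
  obtain rfl | hl := eq_or_ne l j
  · rw [← AlgEquiv.mul_apply, hx.translation_mul_transvection hij, AlgEquiv.mul_apply,
      AlgEquiv.mul_apply, hf, h i hij]
  · exact h l hl c

theorem restrictAut_transvection_apply (hx : IsAffineSteinberg x) {i j : Fin n} (hij : i ≠ j)
    (a : k) (f : invariantField (translations x)) :
    ((invariantField (translations x)).restrictAut (x i (some j) a) f : K) = x i (some j) a f := by
  refine IntermediateField.restrictAut_apply
    (fun f hf => hx.transvection_mem_invariantField hij a hf) (fun f hf => ?_) f
  rw [← hx.map_neg (by simpa using hij)]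
  exact hx.transvection_mem_invariantField hij _ hf

/-- The automorphisms indexed by linear forms act on the fixed field of the translations; fixing the
direction `p`, one gets data of the same kind in one dimension less. -/
theorem restrictAut {m : ℕ} {x : Fin (m + 1) → Option (Fin (m + 1)) → k → (K ≃ₐ[k] K)}
    (hx : IsAffineSteinberg x) (p : Fin (m + 1)) :
    IsAffineSteinberg fun (i : Fin m) β a => (invariantField (translations x)).restrictAut
      (x ((finSuccEquiv' p).symm (some i)) (some ((finSuccEquiv' p).symm β)) a) := by
  have hinj {β γ : Option (Fin m)} (h : β ≠ γ) :
      (finSuccEquiv' p).symm β ≠ (finSuccEquiv' p).symm γ := fun h' => h (by simpa using h')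
  have hinj' {β γ : Option (Fin m)} (h : β ≠ γ) :
      some ((finSuccEquiv' p).symm β) ≠ some ((finSuccEquiv' p).symm γ) :=
    fun h' => hinj h (Option.some_injective _ h')
  have happ {i j : Fin (m + 1)} (hij : i ≠ j) := hx.restrictAut_transvection_apply hij
  refine ⟨fun {i β} h a b => ?_, fun {i j β} h₁ h₂ h₃ a b => ?_,
    fun {i j β γ} h₁ h₂ h₃ h₄ a b => ?_⟩
  · ext f
    simp only [AlgEquiv.mul_apply, happ (hinj h)]
    rw [hx.map_add (hinj' h), AlgEquiv.mul_apply]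
  · ext f
    have h₁' : (some i : Option (Fin m)) ≠ some j := by simpa using h₁
    simp only [AlgEquiv.mul_apply, happ (hinj h₁'), happ (hinj h₂), happ (hinj h₃)]
    simp only [← AlgEquiv.mul_apply]
    rw [hx.mul_comm_eq (hinj h₁') (hinj' h₂) (hinj' h₃), mul_assoc]
  · ext f
    simp only [AlgEquiv.mul_apply, happ (hinj h₁), happ (hinj h₂)]
    simp only [← AlgEquiv.mul_apply]
    rw [(hx.commute (hinj' h₁) (hinj' h₂) (hinj' h₃) (hinj' h₄) a b).eq]

theorem exists_derivation_cocycle [CharZero k] [Uncountable k] [Algebra.EssFiniteType k K]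
    [CharZero K] {i₀ : Fin n} (hinj : Function.Injective (x i₀ none)) {S : Set (K ≃ₐ[k] K)}
    (hS : S.Countable) :
    ∃ δ : (K ≃ₐ[k] K) → Derivation k K K,
      (∀ s t, δ (s * t) = Derivation.conj s (δ t) + δ s) ∧ (∀ s ∈ S, δ s = 0) ∧
        ∃ b, δ (x i₀ none b) ≠ 0 := by
  obtain ⟨y, hy⟩ := exists_finset_isTranscendenceBasis k K
  obtain ⟨z, hz⟩ := IntermediateField.fg_top k K
  let U : Set K := Set.range fun p : k × z => x i₀ none p.1 p.2
  have hU : ¬ U.Countable := by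
    intro hU
    have : Countable U := hU
    let ev : k → (z → U) := fun c f => ⟨x i₀ none c f, (c, f), rfl⟩
    refine not_countable (α := k) (Function.Injective.countable (f := ev) fun a b hab => hinj ?_)
    have hle : IntermediateField.adjoin k (z : Set K) ≤
        invariantField {(x i₀ none a)⁻¹ * x i₀ none b} := by
      rw [IntermediateField.adjoin_le_iff]
      rintro f hf _ rfl
      have : x i₀ none a f = x i₀ none b f := congr(($hab ⟨f, hf⟩ : K))
      rw [AlgEquiv.mul_apply, ← this, ← AlgEquiv.mul_apply, inv_mul_cancel, AlgEquiv.one_apply]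
    have h1 : (x i₀ none a)⁻¹ * x i₀ none b = 1 := by
      ext f
      exact hle (hz ▸ IntermediateField.mem_top) _ rfl
    exact inv_mul_eq_one.1 h1
  let S' : Set K := z ∪ ⋃ s ∈ S, (fun f => s f) '' (y : Set K)
  have hS' : S'.Countable := z.countable_toSet.union
    (hS.biUnion fun s _ => y.countable_toSet.image _)
  obtain ⟨D, hDk, hDy, hDS, _, ⟨⟨b, f⟩, rfl⟩, hDU⟩ := exists_derivation_apply_ne_zero hy hS' hU
  refine ⟨D.cocycle hDk, D.cocycle_mul hDk, fun s hs => ?_, b, fun h => hDU ?_⟩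
  · refine D.cocycle_eq_zero hDk hy s hDy fun i => hDS _ (Or.inr ?_)
    exact Set.mem_biUnion hs ⟨i, i.2, rfl⟩
  · have := congr($h (x i₀ none b f))
    simpa [Derivation.cocycle_apply, hDS f (Or.inl f.2)] using this

/-- If the transvections act trivially on the fixed field of the translations, there are at least
`n` independent derivations. -/
theorem exists_linearIndependent_derivation [CharZero k] [Uncountable k]
    [Algebra.EssFiniteType k K] [CharZero K] [Nontrivial (Fin n)] (hx : IsAffineSteinberg x)
    (htriv : ∀ i j, i ≠ j → ∀ f ∈ invariantField (translations x), x i (some j) 1 f = f)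
    {i₀ : Fin n} {c₀ : k} (h₀ : x i₀ none c₀ ≠ 1) :
    ∃ d : Fin n → Derivation k K K, LinearIndependent K d := by
  obtain ⟨S₀, hS₀T, hS₀, hinv⟩ := hx.isRationallyDivisible.exists_countable_invariantField_eq
  obtain ⟨S, hST, hS, hSinv⟩ := exists_countable_invariantDerivations_subset hS₀T hS₀ hinv
  let S' : Set (K ≃ₐ[k] K) := S ∪ Set.range fun p : Fin n × Fin n => x p.1 (some p.2) 1
  obtain ⟨δ, hmul, hδS, b, hb⟩ := exists_derivation_cocycle (hx.injective_translation h₀)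
    (S := S') (hS.union (Set.countable_range _))
  have hδu : ∀ i j, δ (x i (some j) 1) = 0 := fun i j => hδS _ (Or.inr ⟨(i, j), rfl⟩)
  have hd : ∀ i, δ (x i none b) ∈ invariantDerivations (translations x) := by
    refine fun i => hSinv fun s hs => ?_
    have hδs : δ s = 0 := hδS _ (Or.inl hs)
    obtain ⟨⟨j, c⟩, rfl⟩ := hST hs
    have := congr(δ $((hx.commute_translation j i c b).eq))
    rwa [hmul, hmul, hδs, _root_.map_zero, add_zero, zero_add] at this
  refine ⟨fun i => δ (x i none b), linearIndependent_of_conj_eq_sub htriv hd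
    (fun i j hij => ?_) (fun i j l hij hlj => ?_) hb⟩
  · have := congr(δ $(hx.translation_mul_transvection hij 1 b))
    rw [mul_assoc, hmul, hmul, hmul (x i (some j) 1), hδu, _root_.map_zero, zero_add, add_zero,
      one_mul, ← sub_eq_iff_eq_add] at this
    refine Derivation.conj_injective (x i none b) ?_
    have h1 := hd j _ ⟨(i, b), rfl⟩
    have h2 := hd i _ ⟨(i, b), rfl⟩
    rw [← this, map_sub, h1, h2]
  · have := congr(δ $((hx.commute_transvection hij hlj 1 b).eq))
    rwa [hmul, hmul, hδu, _root_.map_zero, add_zero, zero_add] at this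

end IsAffineSteinberg

theorem Derivation.card_le_trdeg [CharZero K] [FinTrdeg k K] {ι : Type*} [Fintype ι]
    {d : ι → Derivation k K K} (hd : LinearIndependent K d) :
    (Fintype.card ι : Cardinal) ≤ Algebra.trdeg k K := by
  obtain ⟨y, hy⟩ := exists_finset_isTranscendenceBasis k K
  have h := (hd.map' _ (LinearMap.ker_eq_bot.2
    (Derivation.evalPi_injective hy))).fintype_card_le_finrank
  rw [Module.finrank_fintype_fun_eq_card] at h
  rw [← hy.cardinalMk_eq_trdeg, Cardinal.mk_fintype]
  exact_mod_cast h

/-- In a finitely generated extension of transcendence degree less than `n`, the translations act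
trivially. -/
theorem IsAffineSteinberg.translation_eq_one {k : Type u} [Field k] [CharZero k] [Uncountable k]
    (n : ℕ) : ∀ (K : Type v) [Field K] [Algebra k K] [Algebra.EssFiniteType k K]
      {x : Fin n → Option (Fin n) → k → (K ≃ₐ[k] K)}, IsAffineSteinberg x →
      Algebra.trdeg k K < n → ∀ i c, x i none c = 1 := by
  induction n with
  | zero => exact fun _ _ _ _ _ _ _ i => i.elim0
  | succ m ih =>
    intro K _ _ _ x hx htr i₀ c₀
    by_contra h₀
    have : CharZero K := charZero_of_injective_algebraMap (algebraMap k K).injective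
    set L := invariantField (translations x) with hL
    have hne : Algebra.trdeg L K ≠ 0 := by
      intro h
      have := trdeg_eq_zero_iff.1 h
      refine h₀ (AlgEquiv.ext fun f => ?_)
      exact mem_invariantField_translations.1 (hx.isRationallyDivisible.invariantField_isAlgClosed
        (Algebra.IsAlgebraic.isAlgebraic (R := L) f)) i₀ c₀
    have hLtr : Algebra.trdeg k L < m := by
      by_contra! hle
      refine htr.not_ge ?_
      rw [← trdeg_add_eq k L (A := K), Nat.cast_succ]
      exact add_le_add hle (Cardinal.one_le_iff_ne_zero.2 hne)
    have hm : m ≠ 0 := by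
      rintro rfl
      exact not_lt_zero hLtr
    have : Nontrivial (Fin (m + 1)) := Fin.nontrivial_iff_two_le.2 (by lia)
    have : Algebra.EssFiniteType k L := Algebra.EssFiniteType.of_field_tower k L K
    have htriv : ∀ i j, i ≠ j → ∀ f ∈ L, x i (some j) 1 f = f := by
      intro i j hij f hf
      obtain ⟨i, rfl⟩ := Fin.exists_succAbove_eq hij
      have := congr(($(ih L (hx.restrictAut j) hLtr i 1) ⟨f, hf⟩ : K))
      rwa [finSuccEquiv'_symm_some, finSuccEquiv'_symm_none,
        hx.restrictAut_transvection_apply hij] at this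
    obtain ⟨d, hd⟩ := hx.exists_linearIndependent_derivation htriv h₀
    refine htr.not_ge ?_
    simpa using Derivation.card_le_trdeg hd

end Main

section Elementary

open MvPolynomial

variable {R : Type*} [CommRing R] {n : ℕ}

/-- The affine-linear monomial `1` or `X j`. -/
noncomputable def affineMonomial (R : Type*) [CommRing R] {n : ℕ} (β : Option (Fin n)) :
    MvPolynomial (Fin n) R := β.elim 1 X

/-- The elementary substitution `X i ↦ X i + a * β`. -/
noncomputable def elementaryHom (i : Fin n) (β : Option (Fin n)) (a : R) :
    MvPolynomial (Fin n) R →ₐ[R] MvPolynomial (Fin n) R :=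
  aeval (Function.update X i (X i + C a * affineMonomial R β))

@[simp]
theorem elementaryHom_X_self (i : Fin n) (β : Option (Fin n)) (a : R) :
    elementaryHom i β a (X i) = X i + C a * affineMonomial R β := by
  simp [elementaryHom]

theorem elementaryHom_X_of_ne {i l : Fin n} (β : Option (Fin n)) (a : R) (h : l ≠ i) :
    elementaryHom i β a (X l) = X l := by
  simp [elementaryHom, h]

theorem elementaryHom_affineMonomial {i : Fin n} {γ : Option (Fin n)} (β : Option (Fin n)) (a : R)
    (h : some i ≠ γ) : elementaryHom i β a (affineMonomial R γ) = affineMonomial R γ := by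
  cases γ with
  | none => simp [affineMonomial]
  | some l => exact elementaryHom_X_of_ne β a (by rintro rfl; exact h rfl)

@[simp]
theorem elementaryHom_C (i : Fin n) (β : Option (Fin n)) (a b : R) :
    elementaryHom i β a (C b) = C b := by
  simp [elementaryHom]

theorem elementaryHom_comp {i : Fin n} {β : Option (Fin n)} (h : some i ≠ β) (a b : R) :
    (elementaryHom i β a).comp (elementaryHom i β b) = elementaryHom i β (a + b) := by
  refine MvPolynomial.algHom_ext fun l => ?_
  obtain rfl | hl := eq_or_ne l i
  · simp [elementaryHom_affineMonomial β a h]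
    ring
  · simp [elementaryHom_X_of_ne _ _ hl]

theorem elementaryHom_zero (i : Fin n) (β : Option (Fin n)) :
    elementaryHom i β (0 : R) = AlgHom.id R _ := by
  refine MvPolynomial.algHom_ext fun l => ?_
  obtain rfl | hl := eq_or_ne l i
  · simp
  · simp [elementaryHom_X_of_ne _ _ hl]

/-- The elementary automorphism `X i ↦ X i + a * β`, for `β ≠ X i`. -/
noncomputable def elementaryAut (i : Fin n) (β : Option (Fin n)) (a : R) :
    MvPolynomial (Fin n) R ≃ₐ[R] MvPolynomial (Fin n) R :=
  if h : some i ≠ β then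
    AlgEquiv.ofAlgHom (elementaryHom i β a) (elementaryHom i β (-a))
      (by rw [elementaryHom_comp h, add_neg_cancel, elementaryHom_zero])
      (by rw [elementaryHom_comp h, neg_add_cancel, elementaryHom_zero])
  else 1

theorem elementaryAut_apply {i : Fin n} {β : Option (Fin n)} (h : some i ≠ β) (a : R)
    (p : MvPolynomial (Fin n) R) : elementaryAut i β a p = elementaryHom i β a p := by
  rw [elementaryAut, dif_pos h]
  rfl

theorem MvPolynomial.algEquiv_ext {f g : MvPolynomial (Fin n) R ≃ₐ[R] MvPolynomial (Fin n) R}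
    (h : ∀ i, f (X i) = g (X i)) : f = g :=
  AlgEquiv.coe_toAlgHom_injective (MvPolynomial.algHom_ext h)

theorem isAffineSteinberg_elementaryAut (k : Type*) [Field k] (n : ℕ) :
    IsAffineSteinberg fun (i : Fin n) β (a : k) => elementaryAut i β a where
  map_add h a b := by
    ext p
    rw [AlgEquiv.mul_apply, elementaryAut_apply h, elementaryAut_apply h, elementaryAut_apply h,
      ← elementaryHom_comp h, AlgHom.comp_apply]
  mul_comm_eq {i j β} h₁ h₂ h₃ a b := by
    have h₁' : some i ≠ some j := by simpa using h₁
    refine MvPolynomial.algEquiv_ext fun l => ?_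
    simp only [AlgEquiv.mul_apply, elementaryAut_apply h₁', elementaryAut_apply h₂,
      elementaryAut_apply h₃]
    obtain rfl | hi := eq_or_ne l i
    · simp [affineMonomial, elementaryHom_X_of_ne _ _ h₁, elementaryHom_X_of_ne _ _ h₁.symm]
      ring
    · obtain rfl | hj := eq_or_ne l j
      · simp [elementaryHom_affineMonomial _ _ h₃, elementaryHom_X_of_ne _ _ hi]
      · simp [elementaryHom_X_of_ne _ _ hi, elementaryHom_X_of_ne _ _ hj]
  commute {i j β γ} h₁ h₂ h₃ h₄ a b := by
    refine MvPolynomial.algEquiv_ext fun l => ?_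
    simp only [AlgEquiv.mul_apply, elementaryAut_apply h₁, elementaryAut_apply h₂]
    obtain rfl | hi := eq_or_ne l i <;> obtain rfl | hj := eq_or_ne l j
    · simp [elementaryHom_affineMonomial _ _ h₁, elementaryHom_affineMonomial _ _ h₂]
      ring
    · simp [elementaryHom_affineMonomial _ _ h₃, elementaryHom_X_of_ne _ _ hj]
    · simp [elementaryHom_affineMonomial _ _ h₄, elementaryHom_X_of_ne _ _ hi]
    · simp [elementaryHom_X_of_ne _ _ hi, elementaryHom_X_of_ne _ _ hj]

theorem elementaryAut_ne_one [Nontrivial R] (i : Fin n) : elementaryAut i none (1 : R) ≠ 1 := by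
  intro h
  have := congr($h (X i))
  rw [elementaryAut_apply (by simp)] at this
  simp [affineMonomial] at this

end Elementary

section Lower

theorem trdeg_fractionRing_mvPolynomial (k : Type*) [Field k] (n : ℕ) :
    Algebra.trdeg k (FractionRing (MvPolynomial (Fin n) k)) = n := by
  have : Algebra.IsAlgebraic (MvPolynomial (Fin n) k) (FractionRing (MvPolynomial (Fin n) k)) :=
    IsLocalization.isAlgebraic _ (nonZeroDivisors _)
  rw [← trdeg_add_eq k (MvPolynomial (Fin n) k), trdeg_eq_zero_iff.2 this,
    MvPolynomial.trdeg_of_isDomain]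
  simp

/-- An embedding between Cremona groups cannot decrease the dimension. -/
theorem le_of_injective_monoidHom {k : Type*} [Field k] [CharZero k] [Uncountable k] {m n : ℕ}
    (φ : (FractionRing (MvPolynomial (Fin n) k) ≃ₐ[k] FractionRing (MvPolynomial (Fin n) k)) →*
      (FractionRing (MvPolynomial (Fin m) k) ≃ₐ[k] FractionRing (MvPolynomial (Fin m) k)))
    (hφ : Function.Injective φ) : n ≤ m := by
  by_contra! hlt
  let ψ := φ.comp (IsFractionRing.fieldEquivOfAlgEquivHom (A := k)
    (B := MvPolynomial (Fin n) k) k (FractionRing (MvPolynomial (Fin n) k)))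
  have hψ : Function.Injective ψ :=
    hφ.comp (IsFractionRing.fieldEquivOfAlgEquivHom_injective _ _ _ _)
  have h := ((isAffineSteinberg_elementaryAut k n).map ψ).translation_eq_one n _
    (by rw [trdeg_fractionRing_mvPolynomial]; exact_mod_cast hlt)
    ⟨0, by lia⟩ 1
  exact elementaryAut_ne_one _ (hψ (h.trans (_root_.map_one ψ).symm))

end Lower

section Upper

open MvPolynomial

variable {F : Type*} [Field F]

/-- A subfield of a rational function field containing the constants and the variables is
everything. -/
theorem mem_subfield_of_C_mem_of_X_mem {ι : Type*} {S : Subfield (FractionRing (MvPolynomial ι F))}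
    (hC : ∀ a, algebraMap _ _ (C a : MvPolynomial ι F) ∈ S)
    (hX : ∀ i, algebraMap _ _ (X i : MvPolynomial ι F) ∈ S) (z : FractionRing (MvPolynomial ι F)) :
    z ∈ S := by
  have h : ∀ p : MvPolynomial ι F, algebraMap _ _ p ∈ S := by
    intro p
    induction p using MvPolynomial.induction_on with
    | C a => exact hC a
    | add p q hp hq => rw [map_add]; exact add_mem hp hq
    | mul_X p i hp => rw [map_mul]; exact mul_mem hp (hX i)
  obtain ⟨p, q, -, rfl⟩ := IsFractionRing.div_surjective (MvPolynomial ι F) z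
  exact div_mem (h p) (h q)

/-- Rational functions over a rational function field are rational functions in more variables. -/
noncomputable def fractionRingMvPolynomialSum (k ι κ : Type*) [Field k] :
    FractionRing (MvPolynomial (ι ⊕ κ) k) ≃ₐ[k]
      FractionRing (MvPolynomial ι (FractionRing (MvPolynomial κ k))) := by
  let F := FractionRing (MvPolynomial κ k)
  let E := FractionRing (MvPolynomial ι F)
  let y : κ → E := fun j => algebraMap F E (algebraMap _ F (X j : MvPolynomial κ k))
  let x : ι → E := fun i => algebraMap _ E (X i : MvPolynomial ι F)
  have hx : AlgebraicIndependent F x := by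
    have := (MvPolynomial.algebraicIndependent_X ι F).map' (f := IsScalarTower.toAlgHom F _ E)
      (IsFractionRing.injective _ _)
    exact this
  have hy : AlgebraicIndependent k y := by
    have := (MvPolynomial.algebraicIndependent_X κ k).map'
      (f := (IsScalarTower.toAlgHom k F E).comp (IsScalarTower.toAlgHom k _ F))
      ((algebraMap F E).injective.comp (IsFractionRing.injective _ _))
    exact this
  have hxy : AlgebraicIndependent k (Sum.elim x y) := hy.sumElim_of_tower
    (by rintro _ ⟨j, rfl⟩; exact ⟨_, rfl⟩) hx
  refine hxy.aevalEquivField.trans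
    ((IntermediateField.equivOfEq ?_).trans IntermediateField.topEquiv)
  rw [eq_top_iff]
  intro z _
  set L := IntermediateField.adjoin k (Set.range (Sum.elim x y))
  refine mem_subfield_of_C_mem_of_X_mem (S := L.toSubfield) (fun a => ?_) (fun i => ?_) z
  · refine mem_subfield_of_C_mem_of_X_mem (S := L.toSubfield.comap (algebraMap F E))
      (fun b => ?_) (fun j => ?_) a
    · exact L.algebraMap_mem b
    · exact IntermediateField.subset_adjoin _ _ ⟨Sum.inr j, rfl⟩
  · exact IntermediateField.subset_adjoin _ _ ⟨Sum.inl i, rfl⟩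

/-- Automorphisms act on polynomials through their coefficients. -/
noncomputable def MvPolynomial.mapAutHom (k F ι : Type*) [Field k] [Field F] [Algebra k F] :
    (F ≃ₐ[k] F) →* (MvPolynomial ι F ≃ₐ[k] MvPolynomial ι F) where
  toFun := MvPolynomial.mapAlgEquiv ι
  map_one' := MvPolynomial.mapAlgEquiv_refl ι
  map_mul' f g := (MvPolynomial.mapAlgEquiv_trans ι g f).symm

theorem MvPolynomial.mapAutHom_injective (k F ι : Type*) [Field k] [Field F] [Algebra k F] :
    Function.Injective (MvPolynomial.mapAutHom k F ι) := by
  intro f g h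
  ext a
  have h' : MvPolynomial.map (f : F →+* F) (C a : MvPolynomial ι F) =
      MvPolynomial.map (g : F →+* F) (C a) := congr($h (C a))
  simpa using h'

/-- Automorphisms act on rational functions through their coefficients. -/
noncomputable def coeffAutHom (k F ι : Type*) [Field k] [Field F] [Algebra k F] :
    (F ≃ₐ[k] F) →* (FractionRing (MvPolynomial ι F) ≃ₐ[k] FractionRing (MvPolynomial ι F)) :=
  (IsFractionRing.fieldEquivOfAlgEquivHom (A := k) (B := MvPolynomial ι F) k
    (FractionRing (MvPolynomial ι F))).comp (MvPolynomial.mapAutHom k F ι)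

theorem coeffAutHom_injective (k F ι : Type*) [Field k] [Field F] [Algebra k F] :
    Function.Injective (coeffAutHom k F ι) :=
  (IsFractionRing.fieldEquivOfAlgEquivHom_injective k (MvPolynomial ι F) k
    (FractionRing (MvPolynomial ι F))).comp (MvPolynomial.mapAutHom_injective k F ι)

theorem exists_injective_monoidHom_of_le (k : Type*) [Field k] {m n : ℕ} (h : m ≤ n) :
    ∃ φ : (FractionRing (MvPolynomial (Fin m) k) ≃ₐ[k] FractionRing (MvPolynomial (Fin m) k)) →*
      (FractionRing (MvPolynomial (Fin n) k) ≃ₐ[k] FractionRing (MvPolynomial (Fin n) k)),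
      Function.Injective φ := by
  obtain ⟨d, rfl⟩ := Nat.exists_eq_add_of_le' h
  let e : FractionRing (MvPolynomial (Fin (d + m)) k) ≃ₐ[k]
      FractionRing (MvPolynomial (Fin d) (FractionRing (MvPolynomial (Fin m) k))) :=
    (IsFractionRing.fieldEquivOfAlgEquiv k _ (FractionRing (MvPolynomial (Fin d ⊕ Fin m) k))
      (MvPolynomial.renameEquiv k (finSumFinEquiv (m := d) (n := m)).symm)).trans
      (fractionRingMvPolynomialSum k (Fin d) (Fin m))
  exact ⟨(AlgEquiv.autCongr e.symm).toMonoidHom.comp (coeffAutHom k _ (Fin d)),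
    (AlgEquiv.autCongr e.symm).injective.comp (coeffAutHom_injective _ _ _)⟩

end Upper

/-- **Theorem of Cantat.** For `n, k ≥ 1`, there is an injective group homomorphism
`Bir(ℙⁿ_ℂ) → Bir(ℙᵏ_ℂ)` if and only if `n ≤ k`. In particular `Bir(ℙⁿ_ℂ)` and `Bir(ℙᵏ_ℂ)`
are isomorphic as abstract groups if and only if `n = k`. -/
theorem cantat_cremona_embeddings (n k : ℕ) (hn : 1 ≤ n) (hk : 1 ≤ k) :
    ((∃ φ : CremonaN n →* CremonaN k, Function.Injective φ) ↔ n ≤ k) ∧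
    (Nonempty (CremonaN n ≃* CremonaN k) ↔ n = k) := by
  have : Uncountable ℂ := Set.not_countable_univ_iff.1 not_countable_complex
  refine ⟨⟨fun ⟨φ, hφ⟩ => le_of_injective_monoidHom φ hφ, exists_injective_monoidHom_of_le ℂ⟩,
    fun ⟨e⟩ => le_antisymm (le_of_injective_monoidHom e.toMonoidHom e.injective)
      (le_of_injective_monoidHom e.symm.toMonoidHom e.symm.injective), ?_⟩
  rintro rfl
  exact ⟨MulEquiv.refl _⟩
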